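/- arXiv:1311.0750 — 2 statements merged into one kernel-verified Lean document; each statement's English description precedes it below -/
import Mathlib

section
/- Let D = (P_0,P_1,...,P_k) be a non-separating ear decomposition of a finite simple 2-connected graph G and let u be an inner vertex of the last long ear of D. Then for every index i with V̄_i nonempty, the vertex u lies in V̄_i, and for every vertex x in V̄_i the induced subgraph Ḡ_i contains a path from x to u. -/
open SimpleGraph

universe u

variable {V : Type u}

/-- An ear decomposition `(P₀, P₁, …, P_k)` of a graph `G`: `P₀` is a cycle and each
subsequent ear `Pᵢ` (`1 ≤ i ≤ k`, here indexed by `Fin k`) is a path that intersects the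
union of the previous ears exactly in its two endpoints; the edge sets of the ears
partition the edge set of `G`. -/
structure EarDecomposition {V : Type u} (G : SimpleGraph V) where
  /-- the number of path-ears; the ears are `P₀, P₁, …, P_k`. -/
  k : ℕ
  /-- base point of the initial cycle `P₀` -/
  v0 : V
  /-- the initial ear `P₀` -/
  cycle : G.Walk v0 v0
  cycle_isCycle : cycle.IsCycle
  /-- the first endpoint of the ear `Pᵢ` -/
  s : Fin k → V
  /-- the second endpoint of the ear `Pᵢ` -/
  t : Fin k → V
  /-- the ear `Pᵢ`, `1 ≤ i ≤ k` (indexed here by `i-1 : Fin k`) -/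
  path : (i : Fin k) → G.Walk (s i) (t i)
  path_isPath : ∀ i, (path i).IsPath
  path_length_pos : ∀ i, 0 < (path i).length
  /-- the ears cover all edges of `G` -/
  edges_cover : ∀ e ∈ G.edgeSet, e ∈ cycle.edges ∨ ∃ i, e ∈ (path i).edges
  /-- distinct ears have disjoint edge sets -/
  cycle_path_disjoint : ∀ (i : Fin k), ∀ e ∈ (path i).edges, e ∉ cycle.edges
  path_path_disjoint : ∀ i j : Fin k, i ≠ j → ∀ e ∈ (path i).edges, e ∉ (path j).edges
  /-- each ear intersects the union of the previous ears exactly in its endpoints -/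
  meets_prev : ∀ (i : Fin k), ∀ x ∈ (path i).support,
    ((x ∈ cycle.support ∨ ∃ j, j < i ∧ x ∈ (path j).support) ↔ (x = s i ∨ x = t i))

namespace EarDecomposition

variable {G : SimpleGraph V} (D : EarDecomposition G)

/-- The `i`-th ear `Pᵢ` as a subgraph of `G` (`P₀` is the initial cycle). -/
def ear (i : ℕ) : G.Subgraph :=
  if i = 0 then D.cycle.toSubgraph
  else if h : i - 1 < D.k then (D.path ⟨i - 1, h⟩).toSubgraph else ⊥

/-- The vertex set of the `i`-th ear. -/
def earSupport (i : ℕ) : Set V := (D.ear i).verts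

/-- The edge set of the `i`-th ear. -/
def earEdges (i : ℕ) : Set (Sym2 V) := (D.ear i).edgeSet

/-- The set of inner vertices of the `i`-th ear: for a path-ear, the vertices that are
not endpoints; every vertex of the initial cycle `P₀` counts as inner. -/
def inner (i : ℕ) : Set V :=
  if i = 0 then D.earSupport 0
  else if h : i - 1 < D.k then
    {x | x ∈ (D.path ⟨i - 1, h⟩).support ∧ x ≠ D.s ⟨i - 1, h⟩ ∧ x ≠ D.t ⟨i - 1, h⟩}
  else ∅

/-- Ear `Pᵢ` is long if it is not a single edge. -/
def IsLong (i : ℕ) : Prop :=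
  i = 0 ∨ ∃ h : i - 1 < D.k, 2 ≤ (D.path ⟨i - 1, h⟩).length

/-- The subgraph `G_i = P₀ ∪ P₁ ∪ ⋯ ∪ P_i`. -/
def partialGraph (i : ℕ) : G.Subgraph := ⨆ j ∈ Finset.range (i + 1), D.ear j

/-- `V̄ᵢ = V(G) − V(G_i)`. -/
def Vbar (i : ℕ) : Set V := (D.partialGraph i).vertsᶜ

/-- `Ḡᵢ`, the subgraph of `G` induced by `V̄ᵢ`. -/
def Gbar (i : ℕ) : G.Subgraph := (⊤ : G.Subgraph).induce (D.Vbar i)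

/-- An ear decomposition is non-separating if, for every `i`, every inner vertex of `Pᵢ`
has a neighbor in `Ḡᵢ` unless `Ḡᵢ` is empty. -/
def NonSeparating : Prop :=
  ∀ i ≤ D.k, (D.Vbar i).Nonempty → ∀ x ∈ D.inner i, ∃ y ∈ D.Vbar i, G.Adj x y

/-- `birth v` is the minimal `i` such that `Pᵢ` contains `v`. -/
noncomputable def birth (v : V) : ℕ := sInf {i | v ∈ D.earSupport i}

/-- `birthEdge e` is the index `i` such that `Pᵢ` contains the edge `e`. -/
noncomputable def birthEdge (e : Sym2 V) : ℕ := sInf {i | e ∈ D.earEdges i}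

end EarDecomposition

/-- A graph is `k`-connected if it has more than `k` vertices and deleting any set of
fewer than `k` vertices leaves it connected. -/
def KConnected (k : ℕ) (G : SimpleGraph V) : Prop :=
  k + 1 ≤ Nat.card V ∧ ∀ S : Set V, S.ncard < k → (G.induce Sᶜ).Connected

/-- A Mondshein sequence avoiding the edge `ru`: an ear decomposition of `G` such that
(1) `r ∈ P₀`; (2) `P_{birth u}` is the last long ear, contains `u` as its only inner
vertex and does not contain the edge `ru`; (3) the decomposition is non-separating. -/
def IsMondshein {G : SimpleGraph V} (D : EarDecomposition G) (r u : V) : Prop :=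
  r ∈ D.earSupport 0 ∧
  D.IsLong (D.birth u) ∧
  (∀ j ≤ D.k, D.IsLong j → j ≤ D.birth u) ∧
  D.inner (D.birth u) = {u} ∧
  s(r, u) ∉ D.earEdges (D.birth u) ∧
  D.NonSeparating

namespace EarDecomposition

theorem mem_Vbar_iff {V : Type u} {G : SimpleGraph V} (D : EarDecomposition G) (i : ℕ) (x : V) :
    x ∈ D.Vbar i ↔ ∀ j ≤ i, x ∉ D.earSupport j := by
  simp [Vbar, partialGraph, earSupport]

theorem earSupport_zero {V : Type u} {G : SimpleGraph V} (D : EarDecomposition G) (x : V) :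
    x ∈ D.earSupport 0 ↔ x ∈ D.cycle.support := by
  simp [earSupport, ear]

theorem earSupport_succ {V : Type u} {G : SimpleGraph V} (D : EarDecomposition G) (j : ℕ)
    (h : j < D.k) (x : V) :
    x ∈ D.earSupport (j + 1) ↔ x ∈ (D.path ⟨j, h⟩).support := by
  simp [earSupport, ear, h]

theorem inner_succ {V : Type u} {G : SimpleGraph V} (D : EarDecomposition G) (j : ℕ)
    (h : j < D.k) (x : V) :
    x ∈ D.inner (j + 1) ↔ x ∈ (D.path ⟨j, h⟩).support ∧ x ≠ D.s ⟨j, h⟩ ∧ x ≠ D.t ⟨j, h⟩ := by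
  simp [inner, h]

theorem prev_iff {V : Type u} {G : SimpleGraph V} (D : EarDecomposition G) (j : ℕ)
    (h : j < D.k) (x : V) :
    (∃ j' ≤ j, x ∈ D.earSupport j') ↔
      (x ∈ D.cycle.support ∨ ∃ a, a < (⟨j, h⟩ : Fin D.k) ∧ x ∈ (D.path a).support) := by
  constructor
  · rintro ⟨j', hj', hx⟩
    rcases j' with _ | j'
    · exact Or.inl ((D.earSupport_zero x).1 hx)
    · have hk : j' < D.k := by omega
      refine Or.inr ⟨⟨j', hk⟩, ?_, (D.earSupport_succ j' hk x).1 hx⟩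
      exact Fin.mk_lt_mk.2 (by omega)
  · rintro (hx | ⟨⟨a, ha⟩, haj, hx⟩)
    · exact ⟨0, by omega, (D.earSupport_zero x).2 hx⟩
    · have := Fin.mk_lt_mk.1 haj
      exact ⟨a + 1, by omega, (D.earSupport_succ a ha x).2 hx⟩

/-- Inner vertices of an ear avoid all previous ears. -/
theorem inner_mem_Vbar {V : Type u} {G : SimpleGraph V} (D : EarDecomposition G) (i j : ℕ)
    (hij : i < j) (hj : j ≤ D.k) (x : V) (hx : x ∈ D.inner j) : x ∈ D.Vbar i := by
  rw [mem_Vbar_iff]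
  intro a ha hxa
  obtain ⟨j, rfl⟩ : ∃ b, j = b + 1 := ⟨j - 1, by omega⟩
  have hk : j < D.k := by omega
  rw [D.inner_succ j hk] at hx
  have := (D.meets_prev ⟨j, hk⟩ x hx.1).1 ((D.prev_iff j hk x).1 ⟨a, by omega, hxa⟩)
  tauto

theorem isLong_of_inner {V : Type u} {G : SimpleGraph V} (D : EarDecomposition G) (j : ℕ)
    (hj : j ≤ D.k) (x : V) (hx : x ∈ D.inner j) : D.IsLong j := by
  rcases j with _ | j
  · exact Or.inl rfl
  · have hk : j < D.k := by omega
    rw [D.inner_succ j hk] at hx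
    refine Or.inr ⟨hk, ?_⟩
    obtain ⟨n, hn, hle⟩ := Walk.mem_support_iff_exists_getVert.1 hx.1
    show 2 ≤ (D.path ⟨j, hk⟩).length
    by_contra hlt
    rcases Nat.eq_zero_or_pos n with h0 | h0
    · subst h0; exact hx.2.1 (by simpa using hn.symm)
    · have : n = (D.path ⟨j, hk⟩).length := by omega
      subst this; exact hx.2.2 (by simpa using hn.symm)

theorem exists_inner {V : Type u} {G : SimpleGraph V} (D : EarDecomposition G)
    (x y : V) (hxy : G.Adj x y) : ∃ j ≤ D.k, x ∈ D.inner j := by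
  classical
  have hex : ∃ j, j ≤ D.k ∧ x ∈ D.earSupport j := by
    rcases D.edges_cover s(x, y) hxy with h | ⟨⟨a, ha⟩, h⟩
    · exact ⟨0, by omega, (D.earSupport_zero x).2 (Walk.fst_mem_support_of_mem_edges _ h)⟩
    · exact ⟨a + 1, by omega,
        (D.earSupport_succ a ha x).2 (Walk.fst_mem_support_of_mem_edges _ h)⟩
  obtain ⟨hk, hx⟩ := Nat.find_spec hex
  have hmin := fun m => @Nat.find_min _ _ hex m
  refine ⟨Nat.find hex, hk, ?_⟩
  generalize Nat.find hex = j at *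
  rcases j with _ | j
  · simpa [inner] using hx
  · have hk' : j < D.k := by omega
    rw [D.earSupport_succ j hk'] at hx
    rw [D.inner_succ j hk']
    refine ⟨hx, ?_⟩
    by_contra hc
    have hc' : x = D.s ⟨j, hk'⟩ ∨ x = D.t ⟨j, hk'⟩ := by tauto
    obtain ⟨a, ha, hxa⟩ := (D.prev_iff j hk' x).2 ((D.meets_prev ⟨j, hk'⟩ x hx).2 hc')
    exact hmin a (by omega) ⟨by omega, hxa⟩

/-- Reachability in `Gbar i`, with membership bundled. -/
def GbarReach {V : Type u} {G : SimpleGraph V} (D : EarDecomposition G) (i : ℕ) (x y : V) : Prop :=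
  ∃ (hx : x ∈ (D.Gbar i).verts) (hy : y ∈ (D.Gbar i).verts),
    (D.Gbar i).coe.Reachable ⟨x, hx⟩ ⟨y, hy⟩

theorem GbarReach.tr {V : Type u} {G : SimpleGraph V} {D : EarDecomposition G} {i : ℕ} {x y z : V}
    (h : D.GbarReach i x y) (h' : D.GbarReach i y z) : D.GbarReach i x z := by
  obtain ⟨hx, _, h⟩ := h
  obtain ⟨_, hz, h'⟩ := h'
  exact ⟨hx, hz, h.trans h'⟩

theorem GbarReach.sy {V : Type u} {G : SimpleGraph V} {D : EarDecomposition G} {i : ℕ} {x y : V}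
    (h : D.GbarReach i x y) : D.GbarReach i y x := by
  obtain ⟨hx, hy, h⟩ := h
  exact ⟨hy, hx, h.symm⟩

theorem GbarReach.of_adj {V : Type u} {G : SimpleGraph V} {D : EarDecomposition G} {i : ℕ}
    {x y : V} (hx : x ∈ D.Vbar i) (hy : y ∈ D.Vbar i) (h : G.Adj x y) : D.GbarReach i x y := by
  refine ⟨hx, hy, SimpleGraph.Adj.reachable ?_⟩
  simp [Gbar, hx, hy, h]

theorem inner_reach {V : Type u} {G : SimpleGraph V} (D : EarDecomposition G) (i j : ℕ)
    (hij : i < j) (hj : j ≤ D.k) (x y : V) (hx : x ∈ D.inner j) (hy : y ∈ D.inner j) :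
    D.GbarReach i x y := by
  have hV := fun z hz => D.inner_mem_Vbar i j hij hj z hz
  obtain ⟨j, rfl⟩ : ∃ b, j = b + 1 := ⟨j - 1, by omega⟩
  have hk : j < D.k := by omega
  simp only [D.inner_succ j hk] at hx hy hV
  have hp := D.path_isPath ⟨j, hk⟩
  generalize D.path ⟨j, hk⟩ = p at *
  have hVc : ∀ c, 0 < c → c < p.length → p.getVert c ∈ D.Vbar i := by
    intro c h0 hc
    refine hV _ ⟨p.getVert_mem_support c, ?_, ?_⟩
    · intro h
      have := hp.getVert_injOn (x₁ := c) (x₂ := 0) (by simp; omega) (by simp) (by simpa using h)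
      omega
    · intro h
      have := hp.getVert_injOn (x₁ := c) (x₂ := p.length) (by simp; omega) (by simp)
        (by simpa using h)
      omega
  have key : ∀ c, c + 1 < p.length → D.GbarReach i (p.getVert 1) (p.getVert (c + 1)) := by
    intro c
    induction c with
    | zero => intro hc; exact ⟨hVc 1 (by omega) hc, hVc 1 (by omega) hc, Reachable.refl _⟩
    | succ c ih =>
      intro hc
      exact (ih (by omega)).tr (GbarReach.of_adj (hVc _ (by omega) (by omega))
        (hVc _ (by omega) hc) (p.adj_getVert_succ (by omega)))
  have key2 : ∀ z, (z ∈ p.support ∧ z ≠ D.s ⟨j, hk⟩ ∧ z ≠ D.t ⟨j, hk⟩) →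
      D.GbarReach i (p.getVert 1) z := by
    rintro z ⟨hz, hs, ht⟩
    obtain ⟨n, hn, hle⟩ := Walk.mem_support_iff_exists_getVert.1 hz
    rcases n with _ | n
    · exact absurd (by simpa using hn.symm) hs
    · have hne : n + 1 ≠ p.length := by
        intro h
        rw [h] at hn
        exact ht (by simpa using hn.symm)
      rw [← hn]
      exact key n (by omega)
  exact (key2 x hx).sy.tr (key2 y hy)

end EarDecomposition

/-- Let `D` be a non-separating ear decomposition of a finite simple
2-connected graph `G` and let `u` be an inner vertex of the last long ear of `D`. Then
for every index `i` with `V̄ᵢ` nonempty, `u ∈ V̄ᵢ` and, for every `x ∈ V̄ᵢ`, the induced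
subgraph `Ḡᵢ` contains a path from `x` to `u`. -/
theorem gbar_path_to_u {V : Type u} [Fintype V] (G : SimpleGraph V)
    (hG : KConnected 2 G) (D : EarDecomposition G) (hD : D.NonSeparating)
    (L : ℕ) (hL : L ≤ D.k) (hLlong : D.IsLong L)
    (hlast : ∀ j ≤ D.k, D.IsLong j → j ≤ L)
    (u : V) (hu : u ∈ D.inner L)
    (i : ℕ) (hi : i ≤ D.k) (hne : (D.Vbar i).Nonempty) :
    ∃ hu' : u ∈ (D.Gbar i).verts, u ∈ D.Vbar i ∧
      ∀ x, ∀ hx : x ∈ (D.Gbar i).verts, (D.Gbar i).coe.Reachable ⟨x, hx⟩ ⟨u, hu'⟩ := by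
  classical
  obtain ⟨hcard, hconn⟩ := hG
  have hpre : ∀ a b : V, G.Reachable a b := by
    intro a b
    have h := (hconn ∅ (by simp)).preconnected ⟨a, by simp⟩ ⟨b, by simp⟩
    exact h.map (SimpleGraph.Embedding.induce _).toHom
  have hnt : Nontrivial V := by
    rw [Nat.card_eq_fintype_card] at hcard
    exact Fintype.one_lt_card_iff_nontrivial.1 (by omega)
  have hinner : ∀ x : V, ∃ j ≤ D.k, x ∈ D.inner j := by
    intro x
    have hc : G.Preconnected := hpre
    obtain ⟨y, hy⟩ := hc.exists_adj_of_nontrivial x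
    exact D.exists_inner x y hy
  have hgt : ∀ (a : ℕ) (x : V), x ∈ D.Vbar a → ∃ j ≤ D.k, a < j ∧ x ∈ D.inner j := by
    intro a x hx
    obtain ⟨j, hj, hxj⟩ := hinner x
    refine ⟨j, hj, ?_, hxj⟩
    by_contra hle
    refine (D.mem_Vbar_iff a x).1 hx j (by omega) ?_
    rcases j with _ | j
    · simpa [EarDecomposition.inner] using hxj
    · have hk : j < D.k := by omega
      rw [D.inner_succ j hk] at hxj
      exact (D.earSupport_succ j hk x).2 hxj.1
  have hleL : ∀ (j : ℕ) (x : V), j ≤ D.k → x ∈ D.inner j → j ≤ L := fun j x hj hx =>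
    hlast j hj (D.isLong_of_inner j hj x hx)
  have hiL : i < L := by
    obtain ⟨x, hx⟩ := hne
    obtain ⟨j, hj, hij, hxj⟩ := hgt i x hx
    exact lt_of_lt_of_le hij (hleL j x hj hxj)
  have huV := D.inner_mem_Vbar i L hiL hL u hu
  have main : ∀ (n j : ℕ) (x : V), L - j = n → j ≤ D.k → i < j → x ∈ D.inner j →
      D.GbarReach i x u := by
    intro n
    induction n using Nat.strong_induction_on with
    | _ n ih =>
      intro j x hn hj hij hxj
      have hjL := hleL j x hj hxj
      rcases hjL.eq_or_lt with rfl | hlt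
      · exact D.inner_reach i j hij hj x u hxj hu
      · obtain ⟨y, hy, hxy⟩ := hD j hj ⟨u, D.inner_mem_Vbar j L hlt hL u hu⟩ x hxj
        obtain ⟨j', hj', hjj', hyj'⟩ := hgt j y hy
        exact (EarDecomposition.GbarReach.of_adj (D.inner_mem_Vbar i j hij hj x hxj)
          (D.inner_mem_Vbar i j' (by omega) hj' y hyj') hxy).tr
          (ih (L - j') (by omega) j' y rfl hj' (by omega) hyj')
  refine ⟨huV, huV, fun x hx => ?_⟩
  obtain ⟨j, hj, hij, hxj⟩ := hgt i x hx
  obtain ⟨_, _, h⟩ := main _ j x rfl hj hij hxj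
  exact h
end

section
/- If a finite simple graph G has a Mondshein sequence avoiding some edge ru, then every vertex of G has degree at least 3 in G. -/
open SimpleGraph

universe u

variable {V : Type u}

namespace EarDecomposition

theorem aux_mem_succ {G : SimpleGraph V} (D : EarDecomposition G) (i : Fin D.k) (x : V) :
    x ∈ D.earSupport (i.1 + 1) ↔ x ∈ (D.path i).support := by
  simp [earSupport, ear]

theorem aux_mem_zero {G : SimpleGraph V} (D : EarDecomposition G) (x : V) :
    x ∈ D.earSupport 0 ↔ x ∈ D.cycle.support := by
  simp [earSupport, ear]

theorem aux_lt {G : SimpleGraph V} (D : EarDecomposition G) {i : ℕ} {x : V}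
    (h : x ∈ D.earSupport i) : i ≤ D.k := by
  by_contra hi
  have h1 : i ≠ 0 := by omega
  have h2 : ¬ (i - 1 < D.k) := by omega
  simp [earSupport, ear, h1, h2] at h

theorem aux_mem_Vbar {G : SimpleGraph V} (D : EarDecomposition G) {i : ℕ} {x : V} :
    x ∈ D.Vbar i ↔ ∀ j ≤ i, x ∉ D.earSupport j := by
  simp [Vbar, partialGraph, earSupport]

theorem aux_inner {G : SimpleGraph V} (D : EarDecomposition G) {i : ℕ} {x : V}
    (h : x ∈ D.earSupport i) (hm : ∀ j < i, x ∉ D.earSupport j) : x ∈ D.inner i := by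
  have hk := D.aux_lt h
  rcases i with _ | i
  · simpa [inner] using h
  · have hi : i < D.k := by omega
    have hx := (D.aux_mem_succ ⟨i, hi⟩ x).1 h
    have := D.meets_prev ⟨i, hi⟩ x hx
    have h1 : ¬ (x ∈ D.cycle.support ∨ ∃ j, j < (⟨i, hi⟩ : Fin D.k) ∧
        x ∈ (D.path j).support) := by
      rintro (h1 | ⟨j, hj, h1⟩)
      · exact hm 0 (by omega) ((D.aux_mem_zero x).2 h1)
      · exact hm (j.1 + 1) (by have : j.1 < i := hj
                               omega) ((D.aux_mem_succ j x).2 h1)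
    rw [this, not_or] at h1
    simp only [inner, Nat.add_sub_cancel, hi, dif_pos]
    exact ⟨hx, h1.1, h1.2⟩

theorem aux_two {G : SimpleGraph V} (D : EarDecomposition G) {i : ℕ} {x : V}
    (h : x ∈ D.inner i) : ((D.ear i).neighborSet x).ncard = 2 := by
  rcases i with _ | i
  · simp only [inner, if_true] at h
    have := D.cycle_isCycle.ncard_neighborSet_toSubgraph_eq_two ((D.aux_mem_zero x).1 h)
    simpa [ear] using this
  · by_cases hi : i < D.k
    · simp only [inner, Nat.add_sub_cancel, hi, dif_pos] at h
      obtain ⟨hx, hs, ht⟩ := h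
      obtain ⟨n, hn, hl⟩ := Walk.mem_support_iff_exists_getVert.1 hx
      have h0 : n ≠ 0 := by
        rintro rfl
        simp at hn
        exact hs hn.symm
      have h1 : n < (D.path ⟨i, hi⟩).length := by
        rcases lt_or_eq_of_le hl with h | h
        · exact h
        · subst h
          simp at hn
          exact (ht hn.symm).elim
      have := (D.path_isPath ⟨i, hi⟩).ncard_neighborSet_toSubgraph_internal_eq_two h0 h1
      have hn' : (D.path ⟨i, hi⟩).getVert n = x := hn
      rw [hn'] at this
      simpa [ear, hi] using this
    · simp [inner, hi] at h

theorem aux_long {G : SimpleGraph V} (D : EarDecomposition G) {i : ℕ} {x : V}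
    (h : x ∈ D.inner i) : D.IsLong i := by
  rcases i with _ | i
  · exact Or.inl rfl
  · by_cases hi : i < D.k
    · simp only [inner, Nat.add_sub_cancel, hi, dif_pos] at h
      obtain ⟨hx, hs, ht⟩ := h
      refine Or.inr ⟨hi, ?_⟩
      obtain ⟨n, hn, hl⟩ := Walk.mem_support_iff_exists_getVert.1 hx
      by_contra hlt
      change ¬ 2 ≤ (D.path ⟨i, hi⟩).length at hlt
      change n ≤ (D.path ⟨i, hi⟩).length at hl
      have : n = 0 ∨ n = (D.path ⟨i, hi⟩).length := by omega
      rcases this with rfl | rfl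
      · simp at hn
        exact hs hn.symm
      · simp at hn
        exact ht hn.symm
    · simp [inner, hi] at h

theorem aux_min {G : SimpleGraph V} (D : EarDecomposition G) {i : ℕ} {x : V}
    (h : x ∈ D.earSupport i) :
    ∃ j ≤ i, x ∈ D.earSupport j ∧ x ∈ D.inner j ∧ ∀ l < j, x ∉ D.earSupport l := by
  classical
  have hex : ∃ i, x ∈ D.earSupport i := ⟨i, h⟩
  exact ⟨Nat.find hex, Nat.find_min' hex h, Nat.find_spec hex,
    D.aux_inner (Nat.find_spec hex) (fun l hl => Nat.find_min hex hl),
    fun l hl => Nat.find_min hex hl⟩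

theorem aux_three {G : SimpleGraph V} [Finite V] (D : EarDecomposition G) {i : ℕ} {x y : V}
    (h : x ∈ D.inner i) (hy : G.Adj x y) (hn : ¬ (D.ear i).Adj x y) :
    3 ≤ (G.neighborSet x).ncard := by
  have h2 := D.aux_two h
  have hins : (insert y ((D.ear i).neighborSet x)).ncard = 3 := by
    rw [Set.ncard_insert_of_notMem (by simpa using hn) (Set.toFinite _), h2]
  rw [← hins]
  apply Set.ncard_le_ncard _ (Set.toFinite _)
  rintro z (rfl | hz)
  · exact hy
  · exact (D.ear i).adj_sub hz

end EarDecomposition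

/-- If a finite simple graph `G` has a Mondshein sequence avoiding
some edge `ru`, then every vertex of `G` has degree at least `3` in `G`. -/
theorem minDegree_ge_three_of_mondshein {V : Type u} [Fintype V] (G : SimpleGraph V)
    (r u : V) (hru : G.Adj r u) (D : EarDecomposition G) (hD : IsMondshein D r u) :
    ∀ v : V, 3 ≤ (G.neighborSet v).ncard := by
  obtain ⟨hr, hlong, hlast, hinner, hnot, hsep⟩ := hD
  have hui : u ∈ D.inner (D.birth u) := by rw [hinner]; rfl
  have hb : D.birth u ≤ D.k := by
    rcases hlong with h | ⟨h, -⟩ <;> omega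
  have hbmin : ∀ j < D.birth u, u ∉ D.earSupport j := fun j hj h =>
    Nat.notMem_of_lt_sInf hj h
  -- all vertices lie in the first `birth u` ears
  have hV : ¬ (D.Vbar (D.birth u)).Nonempty := by
    intro hne
    obtain ⟨y, hy, hadj⟩ := hsep _ hb hne u hui
    have hcov : ∃ i, y ∈ D.earSupport i := by
      rcases D.edges_cover s(u, y) hadj with h | ⟨i, h⟩
      · exact ⟨0, (D.aux_mem_zero y).2 (Walk.snd_mem_support_of_mem_edges _ h)⟩
      · exact ⟨i.1 + 1, (D.aux_mem_succ i y).2 (Walk.snd_mem_support_of_mem_edges _ h)⟩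
    obtain ⟨i, hi⟩ := hcov
    obtain ⟨j, -, hj, hji, -⟩ := D.aux_min hi
    exact D.aux_mem_Vbar.1 hy j (hlast j (D.aux_lt hj) (D.aux_long hji)) hj
  intro v
  by_cases hvu : v = u
  · subst hvu
    refine D.aux_three hui hru.symm ?_
    intro h
    exact hnot (Subgraph.mem_edgeSet.2 h.symm)
  · have : ∃ i ≤ D.birth u, v ∈ D.earSupport i := by
      by_contra hcon
      push Not at hcon
      exact hV ⟨v, D.aux_mem_Vbar.2 hcon⟩
    obtain ⟨i, hib, hi⟩ := this
    obtain ⟨j, hji, hj, hjin, -⟩ := D.aux_min hi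
    have hjb : j ≠ D.birth u := by
      rintro rfl
      rw [hinner] at hjin
      exact hvu hjin
    have hu : u ∈ D.Vbar j := D.aux_mem_Vbar.2 fun l hl => hbmin l (by omega)
    obtain ⟨y, hy, hadj⟩ := hsep j (by omega) ⟨u, hu⟩ v hjin
    refine D.aux_three hjin hadj fun h => ?_
    exact D.aux_mem_Vbar.1 hy j le_rfl h.snd_mem
end
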